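/- Let X ⊆ ℝ^n be closed with nonempty interior, Y ⊆ ℝ^m nonempty and open, Φ : X × Y → ℝ twice continuously differentiable on int(X) × Y and continuous relative to X × Y, and let g satisfy Assumption (G). Suppose g is prox-regular at x̄ ∈ int X for v̄ ∈ ∂g(x̄) with parameter r > 0, that ȳ ∈ Y satisfies (∂_Φ g)^{-1}(ȳ) = {x̄} and v̄ = ∇_x Φ(x̄, ȳ), and that ∇²_{xx}Φ(x̄, ȳ) is negative definite with λ_max(M) < r^{-1} for M := −(∇²_{xx}Φ(x̄, ȳ))^{-1}. Then: (i) the Φ-conjugate g^Φ is differentiable with locally Lipschitz continuous gradient in a neighborhood of ȳ; (ii) if in addition g is strictly twice epi-differentiable at x̄ for v̄ and prox-bounded with threshold λ_g > λ_max(M), then g^Φ is strictly twice differentiable at ȳ with Hessian ∇²g^Φ(ȳ) = ∇(∂_Φ g)^{-1}(ȳ) · ∇²_{yx}Φ((∂_Φ g)^{-1}(ȳ), ȳ) + ∇²_{yy}Φ((∂_Φ g)^{-1}(ȳ), ȳ). -/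

import Mathlib

set_option linter.unusedVariables false

open Filter Topology Metric Set Bornology
open scoped RealInnerProductSpace NNReal

noncomputable section

variable {E F : Type*} [NormedAddCommGroup E] [InnerProductSpace ℝ E] [CompleteSpace E]
  [NormedAddCommGroup F] [InnerProductSpace ℝ F] [CompleteSpace F]

/-- Gradient of the coupling `Φ` in its first argument. -/
def gradx (Φ : E → F → ℝ) (x : E) (y : F) : E :=
  gradient (fun x' => Φ x' y) x

/-- Gradient of the coupling `Φ` in its second argument. -/
def grady (Φ : E → F → ℝ) (x : E) (y : F) : F :=
  gradient (fun y' => Φ x y') y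

/-- The Φ-conjugate of `f` relative to `X`: `f^Φ(y) = sup_{x ∈ X} (Φ(x,y) − f(x))`. -/
def phiConj (X : Set E) (Φ : E → F → ℝ) (f : E → EReal) (y : F) : EReal :=
  ⨆ x ∈ X, ((Φ x y : EReal) - f x)

/-- The Φ-biconjugate of `f`: `f^{ΦΦ}(x) = sup_{y ∈ Y} (Φ(x,y) − f^Φ(y))`. -/
def phiBiconj (X : Set E) (Y : Set F) (Φ : E → F → ℝ) (f : E → EReal) (x : E) : EReal :=
  ⨆ y ∈ Y, ((Φ x y : EReal) - phiConj X Φ f y)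

/-- `f` is Φ-convex on `X`: `f` is a pointwise supremum over `X` of functions
`x ↦ Φ(x, yᵢ) − βᵢ` with `yᵢ ∈ Y` (the empty index set giving `f ≡ −∞`). -/
def PhiConvexOn (X : Set E) (Y : Set F) (Φ : E → F → ℝ) (f : E → EReal) : Prop :=
  ∃ (ι : Type) (yi : ι → F) (βi : ι → EReal),
    (∀ i, yi i ∈ Y) ∧ ∀ x ∈ X, f x = ⨆ i, ((Φ x (yi i) : EReal) - βi i)

/-- The Φ-subdifferential of `f` at `xb`:
`y ∈ ∂_Φ f(xb)` iff `y ∈ Y` and `f(x) ≥ f(xb) + Φ(x,y) − Φ(xb,y)` for all `x ∈ X`. -/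
def phiSubdiff (X : Set E) (Y : Set F) (Φ : E → F → ℝ) (f : E → EReal) (xb : E) : Set F :=
  {y | y ∈ Y ∧ ∀ x ∈ X, f xb + ((Φ x y - Φ xb y : ℝ) : EReal) ≤ f x}

/-- The Φ-subdifferential of a function `gc` on `Y` (such as `f^Φ`) at `yb`:
`x ∈ ∂_Φ gc(yb)` iff `x ∈ X` and `gc(y) ≥ gc(yb) + Φ(x,y) − Φ(x,yb)` for all `y ∈ Y`. -/
def phiSubdiffDual (X : Set E) (Y : Set F) (Φ : E → F → ℝ) (gc : F → EReal) (yb : F) : Set E :=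
  {x | x ∈ X ∧ ∀ y ∈ Y, gc yb + ((Φ x y - Φ x yb : ℝ) : EReal) ≤ gc y}

/-- The generalized proximal mapping `(∂_Φ g)^{-1}(y) = argmin_{x ∈ X} (g(x) − Φ(x,y))`. -/
def proxSet (X : Set E) (Φ : E → F → ℝ) (g : E → EReal) (y : F) : Set E :=
  {x | x ∈ X ∧ ∀ x' ∈ X, g x - ((Φ x y : ℝ) : EReal) ≤ g x' - ((Φ x' y : ℝ) : EReal)}

/-- Assumption (G): `g` is proper and lsc on `X`, `g − Φ(·,y)` is level-bounded in `x`
locally uniformly in `y`, and the range of the generalized proximal mapping lies in `int X`. -/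
structure AssumptionG (X : Set E) (Y : Set F) (Φ : E → F → ℝ) (g : E → EReal) : Prop where
  proper : ∃ x ∈ X, g x ≠ ⊤
  ne_bot : ∀ x, g x ≠ ⊥
  lsc : LowerSemicontinuousOn g X
  levelBounded : ∀ yb ∈ Y, ∀ α : ℝ, ∃ V ∈ 𝓝 yb, ∃ B : Set E, IsBounded B ∧
    ∀ y ∈ V ∩ Y, {x | x ∈ X ∧ g x - ((Φ x y : ℝ) : EReal) ≤ (α : EReal)} ⊆ B
  ran_interior : ∀ y ∈ Y, proxSet X Φ g y ⊆ interior X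

/-- `v` is a regular (Fréchet) subgradient of `f` at `x`. -/
def IsFSubgrad (f : E → EReal) (x v : E) : Prop :=
  f x ≠ ⊤ ∧ f x ≠ ⊥ ∧ ∀ ε > (0 : ℝ), ∃ δ > (0 : ℝ), ∀ x', ‖x' - x‖ < δ →
    f x + ((⟪v, x' - x⟫ - ε * ‖x' - x‖ : ℝ) : EReal) ≤ f x'

/-- `v` is a limiting (Mordukhovich) subgradient of `f` at `x`. -/
def IsLSubgrad (f : E → EReal) (x v : E) : Prop :=
  f x ≠ ⊤ ∧ f x ≠ ⊥ ∧ ∃ xs vs : ℕ → E,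
    Tendsto xs atTop (𝓝 x) ∧ Tendsto (fun ν => f (xs ν)) atTop (𝓝 (f x)) ∧
    Tendsto vs atTop (𝓝 v) ∧ ∀ ν, IsFSubgrad f (xs ν) (vs ν)

/-- `f` is locally lower semicontinuous at `xb`. -/
def LocallyLscAt (f : E → EReal) (xb : E) : Prop :=
  ∃ ε > (0 : ℝ), ∀ α : EReal, α ≤ f xb + ((ε : ℝ) : EReal) →
    IsClosed {x | x ∈ closedBall xb ε ∧ f x ≤ α}

/-- `g` is prox-regular at `xb` for `vb` with parameter `r`. -/
def ProxRegularAt (g : E → EReal) (xb vb : E) (r : ℝ) : Prop :=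
  g xb ≠ ⊤ ∧ g xb ≠ ⊥ ∧ LocallyLscAt g xb ∧ IsLSubgrad g xb vb ∧
  ∃ ε > (0 : ℝ), ∀ x x' v : E, ‖x' - xb‖ ≤ ε → ‖x - xb‖ ≤ ε →
    g x ≤ g xb + ((ε : ℝ) : EReal) → IsLSubgrad g x v → ‖v - vb‖ ≤ ε →
    g x + ((⟪v, x' - x⟫ - r / 2 * ‖x' - x‖ ^ 2 : ℝ) : EReal) ≤ g x'

/-- `g` is Φ-prox-regular at `xb` for `(vb, yb)`. -/
def PhiProxRegularAt (X : Set E) (Φ : E → F → ℝ) (g : E → EReal)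
    (xb vb : E) (yb : F) : Prop :=
  g xb ≠ ⊤ ∧ g xb ≠ ⊥ ∧ LocallyLscAt g xb ∧ IsLSubgrad g xb vb ∧
  ∃ ε > (0 : ℝ), ∀ (x x' v : E) (y : F), ‖x' - xb‖ ≤ ε → ‖x - xb‖ ≤ ε →
    g x - g xb ≤ ((ε : ℝ) : EReal) → IsLSubgrad g x v → ‖v - vb‖ ≤ ε → ‖y - yb‖ ≤ ε →
    v = gradx Φ x y →
    g x + ((Φ x' y - Φ x y : ℝ) : EReal) ≤ g x'

/-- `g` is Φ-prox-regular at `xb` for `(vb, yb)` with the subgradient inequality strict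
whenever `x' ≠ x`. -/
def PhiProxRegularStrictAt (X : Set E) (Φ : E → F → ℝ) (g : E → EReal)
    (xb vb : E) (yb : F) : Prop :=
  PhiProxRegularAt X Φ g xb vb yb ∧
  ∃ ε > (0 : ℝ), ∀ (x x' v : E) (y : F), ‖x' - xb‖ ≤ ε → ‖x - xb‖ ≤ ε →
    g x - g xb ≤ ((ε : ℝ) : EReal) → IsLSubgrad g x v → ‖v - vb‖ ≤ ε → ‖y - yb‖ ≤ ε →
    v = gradx Φ x y → x' ≠ x →
    g x + ((Φ x' y - Φ x y : ℝ) : EReal) < g x'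

/-- The `g`-attentive `ε`-localization of the limiting subdifferential `∂g` at `xb` for `vb`. -/
def gAttentiveLoc (g : E → EReal) (xb vb : E) (ε : ℝ) (x : E) : Set E :=
  {v | ‖x - xb‖ < ε ∧ g x < g xb + ((ε : ℝ) : EReal) ∧ IsLSubgrad g x v ∧ ‖v - vb‖ < ε}

/-- `Φ` is twist: for each `x ∈ int X` the map `y ↦ ∇ₓΦ(x,y)` is injective on `Y`. -/
def IsTwist (X : Set E) (Y : Set F) (Φ : E → F → ℝ) : Prop :=
  ∀ x ∈ interior X, Set.InjOn (fun y => gradx Φ x y) Y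

/-- `Φ` is a local strong twist at `(xb, yb)`: with `vb := ∇ₓΦ(xb,yb)` there is a unique
continuously differentiable map `G(x,v)` near `(xb,vb)`, with values in `Y`, such that
`G(xb,vb) = yb` and `∇ₓΦ(x, G(x,v)) = v` near `(xb,vb)`. -/
def IsLocalStrongTwist (Y : Set F) (Φ : E → F → ℝ) (xb : E) (yb : F) : Prop :=
  ∃ (G : E × E → F) (U : Set (E × E)), IsOpen U ∧ (xb, gradx Φ xb yb) ∈ U ∧
    ContDiffOn ℝ 1 G U ∧ G (xb, gradx Φ xb yb) = yb ∧ (∀ p ∈ U, G p ∈ Y) ∧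
    (∀ p ∈ U, gradx Φ p.1 (G p) = p.2) ∧
    ∀ (G' : E × E → F) (U' : Set (E × E)), IsOpen U' → (xb, gradx Φ xb yb) ∈ U' →
      ContDiffOn ℝ 1 G' U' → G' (xb, gradx Φ xb yb) = yb → (∀ p ∈ U', G' p ∈ Y) →
      (∀ p ∈ U', gradx Φ p.1 (G' p) = p.2) →
      ∀ᶠ p in 𝓝 (xb, gradx Φ xb yb), G' p = G p

/-- `Φ` is a global strong twist. -/
def IsGlobalStrongTwist (X : Set E) (Y : Set F) (Φ : E → F → ℝ) : Prop :=
  IsTwist X Y Φ ∧ ∀ xb ∈ interior X, ∀ yb ∈ Y, IsLocalStrongTwist Y Φ xb yb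

/-- `σ` is a single-valued localization of the set-valued map `Fm` around `pb` for `qb`,
with domain of localization `U`. -/
def IsSVLocalization {α β : Type*} [TopologicalSpace α] [TopologicalSpace β]
    (Fm : α → Set β) (pb : α) (qb : β) (σ : α → β) (U : Set α) : Prop :=
  U ∈ 𝓝 pb ∧ σ pb = qb ∧ ∃ V ∈ 𝓝 qb, ∀ p ∈ U, Fm p ∩ V = {σ p}

/-- `H` is a first-order approximation to `Fm` at `xb`. -/
def IsFOApprox {α β : Type*} [NormedAddCommGroup α] [NormedAddCommGroup β]
    (Fm H : α → β) (xb : α) : Prop :=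
  H xb = Fm xb ∧ ∀ ε > (0 : ℝ), ∃ V ∈ 𝓝 xb, ∀ x ∈ V, ‖Fm x - H x‖ ≤ ε * ‖x - xb‖

/-- `H` is a strict first-order approximation to `Fm` at `xb`. -/
def IsStrictFOApprox {α β : Type*} [NormedAddCommGroup α] [NormedAddCommGroup β]
    (Fm H : α → β) (xb : α) : Prop :=
  H xb = Fm xb ∧ ∀ ε > (0 : ℝ), ∃ V ∈ 𝓝 xb, ∀ x ∈ V, ∀ x' ∈ V,
    ‖Fm x - H x - (Fm x' - H x')‖ ≤ ε * ‖x - x'‖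

/-- Sequential epi-convergence of `fs` to `f`. -/
def EpiConvergesSeq (fs : ℕ → E → EReal) (f : E → EReal) : Prop :=
  ∀ w : E,
    (∀ ws : ℕ → E, Tendsto ws atTop (𝓝 w) →
      f w ≤ Filter.liminf (fun ν => fs ν (ws ν)) atTop) ∧
    (∃ ws : ℕ → E, Tendsto ws atTop (𝓝 w) ∧
      Filter.limsup (fun ν => fs ν (ws ν)) atTop ≤ f w)

/-- `g` is strictly twice epi-differentiable at `xb` for `vb`: the second-order difference
quotients epi-converge to a common limit along every sequence `tₙ ↘ 0`,
`(xₙ, vₙ) → (xb, vb)` with `vₙ ∈ ∂g(xₙ)` and `g(xₙ) → g(xb)`. -/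
def StrictTwiceEpiDiff (g : E → EReal) (xb vb : E) : Prop :=
  ∃ h : E → EReal, ∀ (ts : ℕ → ℝ) (xs vs : ℕ → E),
    (∀ ν, 0 < ts ν) → Tendsto ts atTop (𝓝 0) →
    Tendsto xs atTop (𝓝 xb) → Tendsto vs atTop (𝓝 vb) →
    (∀ ν, IsLSubgrad g (xs ν) (vs ν)) →
    Tendsto (fun ν => g (xs ν)) atTop (𝓝 (g xb)) →
    EpiConvergesSeq (fun ν w =>
      ((2 / (ts ν) ^ 2 : ℝ) : EReal) *
        (g (xs ν + ts ν • w) - g (xs ν) - ((ts ν * ⟪vs ν, w⟫ : ℝ) : EReal))) h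

/-- `g` is prox-bounded with threshold `lamg`. -/
def ProxBoundedWith (g : E → EReal) (lamg : ℝ) : Prop :=
  ∀ lam : ℝ, 0 < lam → lam < lamg → ∃ (y : E) (b : ℝ), ∀ x : E,
    (b : EReal) ≤ g x + ((1 / (2 * lam) * ‖x - y‖ ^ 2 : ℝ) : EReal)

/-- `φ` is lower-C¹ on the open set `O`: locally a max over a compact index set `Z`
of functions `h(x, ·)` that are continuous in `(x,y)` together with their `y`-gradients. -/
def LowerC1On (φ : F → ℝ) (O : Set F) : Prop :=
  ∀ y₀ ∈ O, ∃ (V : Set F) (Z : Set E) (h : E → F → ℝ) (hy : E → F → F),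
    V ∈ 𝓝 y₀ ∧ IsCompact Z ∧ Z.Nonempty ∧
    ContinuousOn (fun p : E × F => h p.1 p.2) (Z ×ˢ V) ∧
    ContinuousOn (fun p : E × F => hy p.1 p.2) (Z ×ˢ V) ∧
    (∀ x ∈ Z, ∀ y ∈ V, HasGradientAt (h x) (hy x y) y) ∧
    ∀ y ∈ V, (∃ x ∈ Z, φ y = h x y) ∧ ∀ x ∈ Z, h x y ≤ φ y

set_option linter.unusedSectionVars false

section Partial

variable {V W H : Type*} [NormedAddCommGroup V] [NormedSpace ℝ V] [NormedAddCommGroup W]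
  [NormedSpace ℝ W] [NormedAddCommGroup H] [NormedSpace ℝ H]

theorem hasFDerivAt_partial_left
    {f : V × W → H} {f' : V × W →L[ℝ] H} {x : V} {y : W}
    (h : HasFDerivAt f f' (x, y)) :
    HasFDerivAt (fun x' => f (x', y)) (f'.comp (.inl ℝ V W)) x :=
  HasFDerivAt.comp (f := fun x' => (x', y)) x h (hasFDerivAt_prodMk_left x y)

theorem hasFDerivAt_partial_right
    {f : V × W → H} {f' : V × W →L[ℝ] H} {x : V} {y : W}
    (h : HasFDerivAt f f' (x, y)) :
    HasFDerivAt (fun y' => f (x, y')) (f'.comp (.inr ℝ V W)) y :=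
  HasFDerivAt.comp (f := fun y' => (x, y')) y h (hasFDerivAt_prodMk_right x y)

end Partial

section Calculus

variable {Φ : E → F → ℝ} {x : E} {y : F}

theorem hasGradientAt_gradx (h : DifferentiableAt ℝ (fun p : E × F => Φ p.1 p.2) (x, y)) :
    HasGradientAt (fun x' => Φ x' y) (gradx Φ x y) x :=
  (hasFDerivAt_partial_left h.hasFDerivAt).differentiableAt.hasGradientAt

theorem hasGradientAt_grady (h : DifferentiableAt ℝ (fun p : E × F => Φ p.1 p.2) (x, y)) :
    HasGradientAt (fun y' => Φ x y') (grady Φ x y) y :=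
  (hasFDerivAt_partial_right h.hasFDerivAt).differentiableAt.hasGradientAt

theorem contDiffAt_gradx (h : ContDiffAt ℝ 2 (fun p : E × F => Φ p.1 p.2) (x, y)) :
    ContDiffAt ℝ 1 (fun p : E × F => gradx Φ p.1 p.2) (x, y) := by
  have h1 : ContDiffAt ℝ 1 (fun p => (InnerProductSpace.toDual ℝ E).symm
      ((fderiv ℝ (fun p : E × F => Φ p.1 p.2) p).comp (.inl ℝ E F))) (x, y) :=
    (InnerProductSpace.toDual ℝ E).symm.contDiff.contDiffAt.comp _
      ((h.fderiv_right le_rfl).clm_comp contDiffAt_const)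
  refine h1.congr_of_eventuallyEq ?_
  filter_upwards [h.eventually (by simp)] with p hp
  rw [gradx, gradient,
    (hasFDerivAt_partial_left (hp.differentiableAt two_ne_zero).hasFDerivAt).fderiv]

theorem contDiffAt_grady (h : ContDiffAt ℝ 2 (fun p : E × F => Φ p.1 p.2) (x, y)) :
    ContDiffAt ℝ 1 (fun p : E × F => grady Φ p.1 p.2) (x, y) := by
  have h1 : ContDiffAt ℝ 1 (fun p => (InnerProductSpace.toDual ℝ F).symm
      ((fderiv ℝ (fun p : E × F => Φ p.1 p.2) p).comp (.inr ℝ E F))) (x, y) :=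
    (InnerProductSpace.toDual ℝ F).symm.contDiff.contDiffAt.comp _
      ((h.fderiv_right le_rfl).clm_comp contDiffAt_const)
  refine h1.congr_of_eventuallyEq ?_
  filter_upwards [h.eventually (by simp)] with p hp
  rw [grady, gradient,
    (hasFDerivAt_partial_right (hp.differentiableAt two_ne_zero).hasFDerivAt).fderiv]

theorem isSymmetric_fderiv_gradient {f : E → ℝ} (h : ContDiffAt ℝ 2 f x) (u w : E) :
    ⟪fderiv ℝ (gradient f) x u, w⟫ = ⟪u, fderiv ℝ (gradient f) x w⟫ := by
  have hs := h.isSymmSndFDerivAt (by simp) u w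
  have hd : DifferentiableAt ℝ (fderiv ℝ f) x :=
    (h.fderiv_right (m := 1) le_rfl).differentiableAt one_ne_zero
  have hg : DifferentiableAt ℝ (gradient f) x :=
    ((InnerProductSpace.toDual ℝ E).symm.contDiff.contDiffAt.comp x
      (h.fderiv_right (m := 1) le_rfl)).differentiableAt one_ne_zero
  have key : ∀ u w : E, ⟪fderiv ℝ (gradient f) x u, w⟫ = fderiv ℝ (fderiv ℝ f) x u w := by
    intro u w
    have h1 : HasFDerivAt (fun z => ⟪gradient f z, w⟫)
        ((fderiv ℝ (fderiv ℝ f) x).flip w) x := by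
      simp_rw [gradient, InnerProductSpace.toDual_symm_apply]
      simpa using hd.hasFDerivAt.clm_apply (hasFDerivAt_const w x)
    have h2 := hg.hasFDerivAt.inner ℝ (hasFDerivAt_const w x)
    simpa using DFunLike.congr_fun (h2.unique h1) u
  rw [key, hs, real_inner_comm, key]

end Calculus

/-- A bound `⟪M u, u⟫ ≤ lmax ‖u‖²` on the inverse `M` of the positive definite operator `-A`
yields a lower bound on `-A` by any constant below `lmax⁻¹`. -/
theorem exists_coercive_of_inverse_le {V : Type*} [NormedAddCommGroup V]
    [InnerProductSpace ℝ V] {A M : V →L[ℝ] V}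
    (hsymm : ∀ u w, ⟪A u, w⟫ = ⟪u, A w⟫) (hneg : ∀ u, u ≠ 0 → ⟪A u, u⟫ < 0)
    (hAM : A.comp M = -ContinuousLinearMap.id ℝ V) {lmax r : ℝ}
    (hlmax : ∀ u, ⟪M u, u⟫ ≤ lmax * ‖u‖ ^ 2) (hr : 0 < r) (hlr : lmax < r⁻¹) :
    ∃ ρ > r, ∀ u, ρ * ‖u‖ ^ 2 ≤ -⟪A u, u⟫ := by
  have hAM' : ∀ u, A (M u) = -u := fun u => by simpa using DFunLike.congr_fun hAM u
  have hneg' : ∀ u, ⟪A u, u⟫ ≤ 0 := fun u => by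
    rcases eq_or_ne u 0 with rfl | hu
    · simp
    · exact (hneg u hu).le
  rcases le_or_gt lmax 0 with hl | hl
  · refine ⟨r + 1, by linarith, fun u => ?_⟩
    have hMu : M u = 0 := by
      by_contra hne
      have h1 := hneg _ hne
      rw [hAM', inner_neg_left, real_inner_comm] at h1
      nlinarith [hlmax u, sq_nonneg ‖u‖]
    have hu : u = 0 := by simpa [hMu] using (hAM' u).symm
    simp [hu]
  · refine ⟨lmax⁻¹, (lt_inv_comm₀ hl hr).1 hlr, fun w => ?_⟩
    have h1 := hneg' (w - lmax⁻¹ • M w)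
    have h2 : ⟪A (w - lmax⁻¹ • M w), w - lmax⁻¹ • M w⟫ =
        ⟪A w, w⟫ + 2 * lmax⁻¹ * ‖w‖ ^ 2 - lmax⁻¹ ^ 2 * ⟪M w, w⟫ := by
      have h3 : ⟪A w, M w⟫ = -‖w‖ ^ 2 := by
        rw [hsymm, hAM', inner_neg_right, real_inner_self_eq_norm_sq]
      simp only [map_sub, map_smul, hAM', inner_sub_left, inner_sub_right, real_inner_smul_left,
        real_inner_smul_right, inner_neg_left, h3, real_inner_self_eq_norm_sq,
        real_inner_comm w (M w)]
      ring
    have h4 : lmax⁻¹ ^ 2 * ⟪M w, w⟫ ≤ lmax⁻¹ * ‖w‖ ^ 2 :=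
      calc lmax⁻¹ ^ 2 * ⟪M w, w⟫ ≤ lmax⁻¹ ^ 2 * (lmax * ‖w‖ ^ 2) := by gcongr; exact hlmax w
        _ = lmax⁻¹ * ‖w‖ ^ 2 := by field_simp
    linarith

theorem EReal.sub_coe_le_sub_coe_iff {a b : EReal} {s t : ℝ} :
    a - (s : EReal) ≤ b - (t : EReal) ↔ a + ((t - s : ℝ) : EReal) ≤ b := by
  rw [EReal.le_sub_iff_add_le (by simp) (by simp), sub_eq_add_neg, add_assoc, ← EReal.coe_neg,
    ← EReal.coe_add, neg_add_eq_sub]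

theorem mem_proxSet_iff {X : Set E} {Φ : E → F → ℝ} {g : E → EReal} {x : E} {y : F} :
    x ∈ proxSet X Φ g y ↔
      x ∈ X ∧ ∀ x' ∈ X, g x + ((Φ x' y - Φ x y : ℝ) : EReal) ≤ g x' := by
  simp only [proxSet, mem_ofPred_eq, EReal.sub_coe_le_sub_coe_iff]

section ProxStability

variable {X : Set E} {Y : Set F} {Φ : E → F → ℝ} {g : E → EReal} {xb : E} {yb : F} {gb : ℝ}

theorem exists_isBounded_sublevel (hYop : IsOpen Y)
    (hΦc : ContinuousOn (fun p : E × F => Φ p.1 p.2) (X ×ˢ Y)) (hG : AssumptionG X Y Φ g)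
    (hxb : xb ∈ X) (hyb : yb ∈ Y) (hgb : g xb = gb) :
    ∃ (α : ℝ) (B : Set E), IsBounded B ∧ ∀ᶠ y in 𝓝 yb, y ∈ Y ∧
      {x | x ∈ X ∧ g x - ((Φ x y : ℝ) : EReal) ≤ (α : EReal)} ⊆ B ∧
      g xb - ((Φ xb y : ℝ) : EReal) ≤ (α : EReal) := by
  obtain ⟨V, hV, B, hB, hsub⟩ := hG.levelBounded yb hyb (gb - Φ xb yb + 1)
  refine ⟨gb - Φ xb yb + 1, B, hB, ?_⟩
  have hc : ContinuousAt (fun y => Φ xb y) yb :=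
    (hΦc.comp (f := fun y => (xb, y)) (s := Y) (by fun_prop)
      fun y hy => ⟨hxb, hy⟩).continuousAt (hYop.mem_nhds hyb)
  filter_upwards [hV, hYop.mem_nhds hyb, hc.eventually_const_lt (sub_one_lt _)] with y hy hyY hlt
  refine ⟨hyY, hsub y ⟨hy, hyY⟩, ?_⟩
  rw [hgb, ← EReal.coe_sub, EReal.coe_le_coe_iff]
  linarith

theorem eventually_proxSet_nonempty [ProperSpace E] (hXcl : IsClosed X) (hYop : IsOpen Y)
    (hΦc : ContinuousOn (fun p : E × F => Φ p.1 p.2) (X ×ˢ Y)) (hG : AssumptionG X Y Φ g)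
    (hxb : xb ∈ X) (hyb : yb ∈ Y) (hgb : g xb = gb) :
    ∀ᶠ y in 𝓝 yb, (proxSet X Φ g y).Nonempty := by
  obtain ⟨α, B, hB, hev⟩ := exists_isBounded_sublevel hYop hΦc hG hxb hyb hgb
  filter_upwards [hev] with y ⟨hyY, hsub, hxα⟩
  have hK : IsCompact (closure B ∩ X) := hB.isCompact_closure.inter_right hXcl
  have hlsc : LowerSemicontinuousOn (fun x => g x - ((Φ x y : ℝ) : EReal)) X := by
    have h1 : ContinuousOn (fun x => ((-Φ x y : ℝ) : EReal)) X :=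
      continuous_coe_real_ereal.comp_continuousOn
        (hΦc.comp (f := fun x => (x, y)) (by fun_prop) fun x hx => ⟨hx, hyY⟩).neg
    exact hG.lsc.add' h1.lowerSemicontinuousOn fun x _ =>
      EReal.continuousAt_add (by simp) (by simp)
  have hxK : xb ∈ closure B ∩ X := ⟨subset_closure (hsub ⟨hxb, hxα⟩), hxb⟩
  obtain ⟨x, hx, hmin⟩ :=
    LowerSemicontinuousOn.exists_isMinOn ⟨xb, hxK⟩ hK (hlsc.mono inter_subset_right)
  rw [isMinOn_iff] at hmin
  refine ⟨x, hx.2, fun x' hx' => ?_⟩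
  by_cases h : g x' - ((Φ x' y : ℝ) : EReal) ≤ α
  · exact hmin x' ⟨subset_closure (hsub ⟨hx', h⟩), hx'⟩
  · exact (hmin xb hxK).trans (hxα.trans (not_le.1 h).le)

theorem eventually_proxSet_subset [ProperSpace E] (hXcl : IsClosed X) (hYop : IsOpen Y)
    (hΦc : ContinuousOn (fun p : E × F => Φ p.1 p.2) (X ×ˢ Y)) (hG : AssumptionG X Y Φ g)
    (hyb : yb ∈ Y) (hgb : g xb = gb) (hprox : proxSet X Φ g yb = {xb})
    {U : Set E} (hU : U ∈ 𝓝 xb) :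
    ∀ᶠ y in 𝓝 yb, proxSet X Φ g y ⊆ U := by
  have hxb : xb ∈ proxSet X Φ g yb := by simp [hprox]
  obtain ⟨α, B, hB, hev⟩ := exists_isBounded_sublevel hYop hΦc hG hxb.1 hyb hgb
  have hK : IsCompact (closure B ∩ (X ∩ (interior U)ᶜ)) :=
    hB.isCompact_closure.inter_right (hXcl.inter isOpen_interior.isClosed_compl)
  have hloc : ∀ x ∈ closure B ∩ (X ∩ (interior U)ᶜ), ∀ᶠ z : F × E in 𝓝 (yb, x),
      z.2 ∉ proxSet X Φ g z.1 := by
    rintro x ⟨-, hxX, hxU⟩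
    have hx : x ∉ proxSet X Φ g yb := by
      rw [hprox]
      rintro rfl
      exact hxU (mem_interior_iff_mem_nhds.2 hU)
    have hlt : ((gb + (Φ x yb - Φ xb yb) : ℝ) : EReal) < g x := by
      by_contra hle
      refine hx (mem_proxSet_iff.2 ⟨hxX, fun x' hx' => ?_⟩)
      refine le_trans ?_ ((mem_proxSet_iff.1 hxb).2 x' hx')
      calc g x + ((Φ x' yb - Φ x yb : ℝ) : EReal)
          ≤ ((gb + (Φ x yb - Φ xb yb) : ℝ) : EReal) + ((Φ x' yb - Φ x yb : ℝ) : EReal) :=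
            add_le_add_left (not_lt.1 hle) _
        _ = _ := by rw [hgb, ← EReal.coe_add, ← EReal.coe_add]; congr 1; ring
    obtain ⟨a, ha, hag⟩ := EReal.lt_iff_exists_real_btwn.1 hlt
    have h1 : ∀ᶠ z : F × E in 𝓝 (yb, x), z.2 ∈ X → (a : EReal) < g z.2 :=
      (continuous_snd.tendsto' (yb, x) x rfl).eventually
        (eventually_nhdsWithin_iff.1 (hG.lsc x hxX a hag))
    have hw : ∀ x₀ ∈ X, ContinuousWithinAt (fun p : E × F => Φ p.1 p.2) (X ×ˢ Y) (x₀, yb) :=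
      fun x₀ hx₀ => hΦc _ ⟨hx₀, hyb⟩
    have h2 : ContinuousWithinAt (fun z : F × E => gb + (Φ z.2 z.1 - Φ xb z.1)) (Y ×ˢ X)
        (yb, x) := by
      refine continuousWithinAt_const.add (ContinuousWithinAt.sub ?_ ?_)
      · exact ContinuousWithinAt.comp (x := (yb, x)) (f := fun z : F × E => (z.2, z.1))
          (hw x hxX) (by fun_prop) fun z hz => ⟨hz.2, hz.1⟩
      · exact ContinuousWithinAt.comp (x := (yb, x)) (f := fun z : F × E => (xb, z.1))
          (hw xb hxb.1) (by fun_prop) fun z hz => ⟨hxb.1, hz.1⟩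
    have h3 := eventually_nhdsWithin_iff.1
      (h2.tendsto.eventually_lt_const (EReal.coe_lt_coe_iff.1 ha))
    have h4 : ∀ᶠ z : F × E in 𝓝 (yb, x), z.1 ∈ Y :=
      (continuous_fst.tendsto' (yb, x) yb rfl).eventually (hYop.mem_nhds hyb)
    filter_upwards [h1, h3, h4] with z hz1 hz3 hzY hz
    have h5 := (mem_proxSet_iff.1 hz).2 xb hxb.1
    have h6 : (a : EReal) + ((Φ xb z.1 - Φ z.2 z.1 : ℝ) : EReal) ≤ gb :=
      (add_le_add_left (hz1 hz.1).le _).trans (hgb ▸ h5)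
    rw [← EReal.coe_add, EReal.coe_le_coe_iff] at h6
    linarith [hz3 ⟨hzY, hz.1⟩]
  filter_upwards [hev, hK.eventually_forall_of_forall_eventually
    (P := fun y x => x ∉ proxSet X Φ g y) hloc] with y ⟨hyY, hsub, hxα⟩ hy x hx
  by_contra hxU
  exact hy x ⟨subset_closure (hsub ⟨hx.1, (hx.2 xb hxb.1).trans hxα⟩), hx.1,
    fun h => hxU (interior_subset h)⟩ hx

theorem eventually_value_mem_Icc [ProperSpace E] (hXcl : IsClosed X) (hYop : IsOpen Y)
    (hΦc : ContinuousOn (fun p : E × F => Φ p.1 p.2) (X ×ˢ Y)) (hG : AssumptionG X Y Φ g)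
    (hxbX : xb ∈ interior X) (hyb : yb ∈ Y) (hgb : g xb = gb) (hprox : proxSet X Φ g yb = {xb})
    {ε : ℝ} (hε : 0 < ε) :
    ∀ᶠ y in 𝓝 yb, ∀ x ∈ proxSet X Φ g y,
      g x ∈ Icc ((gb - ε : ℝ) : EReal) ((gb + ε : ℝ) : EReal) := by
  have hX : X ∈ 𝓝 xb := mem_interior_iff_mem_nhds.1 hxbX
  have hxb := interior_subset hxbX
  have h1 : ∀ᶠ x in 𝓝 xb, ((gb - ε : ℝ) : EReal) < g x := by
    have := hG.lsc xb hxb ((gb - ε : ℝ) : EReal)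
      (by change _ < g xb; rw [hgb, EReal.coe_lt_coe_iff]; linarith)
    rwa [nhdsWithin_eq_nhds.2 hX] at this
  have hc : ContinuousAt (fun p : E × F => Φ p.1 p.2) (xb, yb) :=
    hΦc.continuousAt (prod_mem_nhds hX (hYop.mem_nhds hyb))
  have h2 : ∀ᶠ p : E × F in 𝓝 (xb, yb), Φ p.1 p.2 - Φ xb p.2 < ε := by
    have hc' : ContinuousAt (fun p : E × F => Φ p.1 p.2 - Φ xb p.2) (xb, yb) :=
      hc.sub (ContinuousAt.comp (x := (xb, yb)) (f := fun p : E × F => (xb, p.2)) hc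
        (by fun_prop))
    exact hc'.eventually_lt_const (by simpa using hε)
  obtain ⟨U, hU, V, hV, hUV⟩ := mem_nhds_prod_iff.1 h2
  filter_upwards [hV, eventually_proxSet_subset hXcl hYop hΦc hG hyb hgb hprox
    (inter_mem hU h1)] with y hy hsub x hx
  refine ⟨(hsub hx).2.le, ?_⟩
  have h3 := (mem_proxSet_iff.1 hx).2 xb hxb
  have h4 : Φ x y - Φ xb y < ε := hUV (mk_mem_prod (hsub hx).1 hy)
  rw [hgb] at h3
  generalize g x = c at h3 ⊢
  induction c with
  | bot => simp
  | top => exact absurd h3 (by rw [EReal.top_add_coe]; simp)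
  | coe c =>
    rw [← EReal.coe_add, EReal.coe_le_coe_iff] at h3
    rw [EReal.coe_le_coe_iff]
    linarith

end ProxStability

theorem isLSubgrad_gradx_of_mem_proxSet {X : Set E} {Φ : E → F → ℝ} {g : E → EReal} {x : E} {y : F}
    (hx : x ∈ proxSet X Φ g y) (hxi : x ∈ interior X)
    (hd : DifferentiableAt ℝ (fun p : E × F => Φ p.1 p.2) (x, y))
    (htop : g x ≠ ⊤) (hbot : g x ≠ ⊥) :
    IsLSubgrad g x (gradx Φ x y) := by
  refine ⟨htop, hbot, fun _ => x, fun _ => gradx Φ x y, tendsto_const_nhds, tendsto_const_nhds,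
    tendsto_const_nhds, fun _ => ⟨htop, hbot, fun ε hε => ?_⟩⟩
  have h1 := (hasGradientAt_iff_isLittleO.1 (hasGradientAt_gradx hd)).def hε
  obtain ⟨δ, hδ, h2⟩ := Metric.eventually_nhds_iff.1
    (h1.and (mem_interior_iff_mem_nhds.1 hxi))
  refine ⟨δ, hδ, fun x' hx' => ?_⟩
  obtain ⟨h3, h4⟩ := h2 (y := x') (by rwa [dist_eq_norm])
  refine le_trans (add_le_add_right (EReal.coe_le_coe_iff.2 ?_) _) ((mem_proxSet_iff.1 hx).2 x' h4)
  rw [Real.norm_eq_abs] at h3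
  linarith [(abs_le.1 h3).1]

/-- The subgradient inequality with quadratic slack `r`, for the subgradient `v` of `g` at `x`,
on the closed ball of radius `δ` around `xb`. -/
def ProxIneq (g : E → EReal) (xb : E) (r δ : ℝ) (x v : E) : Prop :=
  ∀ x', ‖x' - xb‖ ≤ δ → g x + ((⟪v, x' - x⟫ - r / 2 * ‖x' - x‖ ^ 2 : ℝ) : EReal) ≤ g x'

theorem ProxIneq.inner_sub_ge {g : E → EReal} {xb x₁ x₂ v₁ v₂ : E} {r δ : ℝ}
    (h₁ : ProxIneq g xb r δ x₁ v₁) (h₂ : ProxIneq g xb r δ x₂ v₂)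
    (hx₁ : ‖x₁ - xb‖ ≤ δ) (hx₂ : ‖x₂ - xb‖ ≤ δ) (htop₁ : g x₁ ≠ ⊤) (hbot₁ : g x₁ ≠ ⊥)
    (htop₂ : g x₂ ≠ ⊤) (hbot₂ : g x₂ ≠ ⊥) :
    -r * ‖x₁ - x₂‖ ^ 2 ≤ ⟪v₁ - v₂, x₁ - x₂⟫ := by
  have h3 := h₁ x₂ hx₂
  have h4 := h₂ x₁ hx₁
  lift g x₁ to ℝ using ⟨htop₁, hbot₁⟩ with a
  lift g x₂ to ℝ using ⟨htop₂, hbot₂⟩ with b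
  rw [← EReal.coe_add, EReal.coe_le_coe_iff] at h3 h4
  rw [norm_sub_rev, ← neg_sub x₁ x₂, inner_neg_right] at h3
  rw [inner_sub_left]
  linarith

/-- Quantitative monotonicity: if `-r ‖d‖² ≤ ⟪w, d⟫` where `w` agrees with `D (d, e)` up to a small
error and `D` is `ρ`-coercive in `-d` with `ρ > r`, then `d` is controlled by `e`. -/
theorem norm_le_of_coercive {D : E × F →L[ℝ] E} {r ρ : ℝ} (hρ : r < ρ)
    (hD : ∀ u, ρ * ‖u‖ ^ 2 ≤ -⟪D (u, 0), u⟫) {d w : E} {e : F}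
    (hw : ‖w - D (d, e)‖ ≤ (ρ - r) / 2 * ‖(d, e)‖) (hmono : -r * ‖d‖ ^ 2 ≤ ⟪w, d⟫) :
    ‖d‖ ≤ (‖D‖ + (ρ - r) / 2) / ((ρ - r) / 2) * ‖e‖ := by
  set c := (ρ - r) / 2 with hc
  have hc0 : 0 < c := by linarith
  rw [div_mul_eq_mul_div, le_div_iff₀ hc0]
  rcases (norm_nonneg d).eq_or_lt with h0 | h0
  · rw [← h0, zero_mul]
    positivity
  have h1 : ⟪w, d⟫ = ⟪D (d, 0), d⟫ + ⟪D (0, e), d⟫ + ⟪w - D (d, e), d⟫ := by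
    rw [← inner_add_left, ← inner_add_left, ← map_add]
    simp
  have h2 : ⟪D (0, e), d⟫ ≤ ‖D‖ * ‖e‖ * ‖d‖ := by
    refine (real_inner_le_norm _ _).trans ?_
    gcongr
    simpa using D.le_opNorm (0, e)
  have h3 : ⟪w - D (d, e), d⟫ ≤ c * (‖d‖ + ‖e‖) * ‖d‖ := by
    refine (real_inner_le_norm _ _).trans ?_
    gcongr
    refine hw.trans ?_
    gcongr
    rw [Prod.norm_mk]
    exact max_le_add_of_nonneg (norm_nonneg _) (norm_nonneg _)
  have h4 : (‖d‖ * c) * ‖d‖ ≤ ((‖D‖ + c) * ‖e‖) * ‖d‖ := by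
    have h5 := hD d
    have h6 : ρ = r + 2 * c := by rw [hc]; ring
    rw [h6] at h5
    linarith
  exact le_of_mul_le_mul_right h4 h0

theorem phiConj_eq_of_mem_proxSet {X : Set E} {Φ : E → F → ℝ} {g : E → EReal} {x : E} {y : F}
    (hx : x ∈ proxSet X Φ g y) {a : ℝ} (ha : g x = a) :
    phiConj X Φ g y = ((Φ x y - a : ℝ) : EReal) := by
  refine le_antisymm (iSup₂_le fun x' hx' => ?_) ?_
  · have h := (mem_proxSet_iff.1 hx).2 x' hx'
    rw [ha, ← EReal.coe_add] at h
    refine (EReal.sub_le_sub le_rfl h).trans ?_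
    rw [← EReal.coe_sub, EReal.coe_le_coe_iff]
    linarith
  · refine le_iSup₂_of_le x hx.1 ?_
    rw [ha, EReal.coe_sub]

theorem hasGradientAt_toReal_phiConj {X : Set E} {Φ : E → F → ℝ} {g : E → EReal} {p : F → E}
    {y₀ : F} (hp : ∀ᶠ y in 𝓝 y₀, p y ∈ proxSet X Φ g y ∧ g (p y) ≠ ⊤ ∧ g (p y) ≠ ⊥)
    (hpc : ContinuousAt p y₀) {f' : E × F →L[ℝ] ℝ}
    (hΦ : HasStrictFDerivAt (fun q : E × F => Φ q.1 q.2) f' (p y₀, y₀)) :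
    HasGradientAt (fun y => (phiConj X Φ g y).toReal) (grady Φ (p y₀) y₀) y₀ := by
  have hval : ∀ y, p y ∈ proxSet X Φ g y ∧ g (p y) ≠ ⊤ ∧ g (p y) ≠ ⊥ →
      (phiConj X Φ g y).toReal = Φ (p y) y - (g (p y)).toReal := fun y hy => by
    rw [phiConj_eq_of_mem_proxSet hy.1 (EReal.coe_toReal hy.2.1 hy.2.2).symm, EReal.toReal_coe]
  have hge : ∀ y y', p y ∈ proxSet X Φ g y ∧ g (p y) ≠ ⊤ ∧ g (p y) ≠ ⊥ →
      p y' ∈ proxSet X Φ g y' ∧ g (p y') ≠ ⊤ ∧ g (p y') ≠ ⊥ →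
      Φ (p y') y - (g (p y')).toReal ≤ Φ (p y) y - (g (p y)).toReal := fun y y' hy hy' => by
    have h := (mem_proxSet_iff.1 hy.1).2 (p y') hy'.1.1
    rw [← EReal.coe_toReal hy.2.1 hy.2.2, ← EReal.coe_toReal hy'.2.1 hy'.2.2, ← EReal.coe_add,
      EReal.coe_le_coe_iff] at h
    linarith
  have hgrad : ∀ e, f' (0, e) = ⟪grady Φ (p y₀) y₀, e⟫ := fun e => by
    have h1 := (hasGradientAt_grady hΦ.hasFDerivAt.differentiableAt).hasFDerivAt.unique
      (hasFDerivAt_partial_right hΦ.hasFDerivAt)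
    simpa using (DFunLike.congr_fun h1 e).symm
  rw [hasGradientAt_iff_isLittleO, Asymptotics.isLittleO_iff]
  intro c hc
  have h1 := hΦ.isLittleO.def hc
  have hid : Tendsto (fun y => (p y, y)) (𝓝 y₀) (𝓝 (p y₀, y₀)) := hpc.prodMk_nhds tendsto_id
  have hid' : Tendsto (fun y => (p y, y₀)) (𝓝 y₀) (𝓝 (p y₀, y₀)) :=
    hpc.prodMk_nhds tendsto_const_nhds
  have hid'' : Tendsto (fun y => (p y₀, y)) (𝓝 y₀) (𝓝 (p y₀, y₀)) :=
    tendsto_const_nhds.prodMk_nhds tendsto_id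
  have h2 := (hid.prodMk_nhds hid').eventually h1
  have h3 := (hid''.prodMk_nhds (tendsto_const_nhds (x := (p y₀, y₀)))).eventually h1
  filter_upwards [hp, h2, h3] with y hy h2 h3
  have hy₀ := hp.self_of_nhds
  simp only [Prod.mk_sub_mk, sub_self, hgrad, Prod.norm_mk, norm_zero, norm_nonneg,
    sup_of_le_right, Real.norm_eq_abs] at h2 h3
  rw [hval y hy, hval y₀ hy₀, Real.norm_eq_abs, abs_le]
  have h4 := hge y y₀ hy hy₀
  have h5 := hge y₀ y hy₀ hy
  constructor
  · linarith [(abs_le.1 h3).1]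
  · linarith [(abs_le.1 h2).2]

theorem HasStrictFDerivAt.tendsto_smul_sub {V W ι : Type*} [NormedAddCommGroup V] [NormedSpace ℝ V]
    [NormedAddCommGroup W] [NormedSpace ℝ W] {f : V → W} {f' : V →L[ℝ] W} {x₀ w : V}
    (hf : HasStrictFDerivAt f f' x₀) {l : Filter ι} {a b : ι → V} {c : ι → ℝ}
    (ha : Tendsto a l (𝓝 x₀)) (hb : Tendsto b l (𝓝 x₀))
    (hc : Tendsto (fun i => c i • (a i - b i)) l (𝓝 w)) :
    Tendsto (fun i => c i • (f (a i) - f (b i))) l (𝓝 (f' w)) := by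
  have h1 := hf.isLittleO.comp_tendsto (ha.prodMk_nhds hb)
  have h2 := (((Asymptotics.isBigO_refl c l).smul_isLittleO h1).trans_isBigO
    (hc.isBigO_one ℝ)).tendsto_zero_of_tendsto tendsto_const_nhds
  refine ((h2.add ((f'.continuous.tendsto w).comp hc)).congr fun i => ?_).trans (by simp)
  simp [smul_sub]

section StrictDifferentiability

variable {V W : Type*} [NormedAddCommGroup V] [NormedSpace ℝ V]
  [NormedAddCommGroup W] [NormedSpace ℝ W]

/-- The difference quotient of `p` in the direction `η`, as a function of the base point and the
step size. -/
def diffQuot (p : V → W) (η : V) (z : V × ℝ) : W := z.2⁻¹ • (p (z.1 + z.2 • η) - p z.1)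

theorem tendsto_add_smul_of_prod {ι : Type*} {x₀ η : V} {l : Filter ι} {z : ι → V × ℝ} {e : ι → V}
    (hz : Tendsto z l (𝓝 x₀ ×ˢ 𝓝[>] (0 : ℝ))) (he : Tendsto e l (𝓝 η)) :
    Tendsto (fun i => (z i).1 + (z i).2 • e i) l (𝓝 x₀) := by
  have h1 : Tendsto (fun i => (z i).1) l (𝓝 x₀) := tendsto_fst.comp hz
  have h2 : Tendsto (fun i => (z i).2) l (𝓝 0) :=
    (tendsto_snd.comp hz).mono_right nhdsWithin_le_nhds
  simpa using h1.add (h2.smul he)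

theorem eventually_norm_diffQuot_sub_le {ι : Type*} {p : V → W} {x₀ η₁ η₂ : V} {K : ℝ≥0}
    {s : Set V} (hs : s ∈ 𝓝 x₀) (hp : LipschitzOnWith K p s) {l : Filter ι} {z : ι → V × ℝ}
    {e₁ e₂ : ι → V} (hz : Tendsto z l (𝓝 x₀ ×ˢ 𝓝[>] (0 : ℝ))) (h₁ : Tendsto e₁ l (𝓝 η₁))
    (h₂ : Tendsto e₂ l (𝓝 η₂)) :
    ∀ᶠ i in l, ‖diffQuot p (e₁ i) (z i) - diffQuot p (e₂ i) (z i)‖ ≤ K * ‖e₁ i - e₂ i‖ := by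
  have h3 : ∀ᶠ i in l, 0 < (z i).2 := (tendsto_snd.comp hz).eventually self_mem_nhdsWithin
  filter_upwards [(tendsto_add_smul_of_prod hz h₁).eventually hs,
    (tendsto_add_smul_of_prod hz h₂).eventually hs, h3] with w h1 h2 h3
  rw [diffQuot, diffQuot, ← smul_sub, sub_sub_sub_cancel_right, norm_smul, norm_inv,
    Real.norm_of_nonneg h3.le, inv_mul_le_iff₀ h3]
  refine (hp.norm_sub_le h1 h2).trans_eq ?_
  rw [add_sub_add_left_eq_sub, ← smul_sub, norm_smul, Real.norm_of_nonneg h3.le]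
  ring

/-- A map that is Lipschitz near `x₀` is strictly differentiable at `x₀` as soon as its difference
quotients with base points tending to `x₀` have a unique cluster point in every direction. -/
theorem exists_hasStrictFDerivAt_of_unique_mapClusterPt [ProperSpace V] [ProperSpace W]
    {p : V → W} {x₀ : V} {K : ℝ≥0} {s : Set V}
    (hs : s ∈ 𝓝 x₀) (hp : LipschitzOnWith K p s)
    (huniq : ∀ η d d', MapClusterPt d (𝓝 x₀ ×ˢ 𝓝[>] (0 : ℝ)) (diffQuot p η) →
      MapClusterPt d' (𝓝 x₀ ×ˢ 𝓝[>] (0 : ℝ)) (diffQuot p η) → d = d') :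
    ∃ D : V →L[ℝ] W, HasStrictFDerivAt p D x₀ := by
  set l := 𝓝 x₀ ×ˢ 𝓝[>] (0 : ℝ) with hl
  have hlip2 : ∀ η η', ∀ᶠ z in l, ‖diffQuot p η' z - diffQuot p η z‖ ≤ K * ‖η' - η‖ :=
    fun η η' => eventually_norm_diffQuot_sub_le hs hp tendsto_id (tendsto_const_nhds (x := η'))
      (tendsto_const_nhds (x := η))
  have hlim : ∀ η, ∃ d, Tendsto (diffQuot p η) l (𝓝 d) := fun η => by
    have hmem : ∀ᶠ z in l, diffQuot p η z ∈ closedBall (0 : W) (K * ‖η‖) := by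
      filter_upwards [hlip2 0 η] with z hz
      simpa [diffQuot] using hz
    obtain ⟨d, -, hd⟩ := (isCompact_closedBall (0 : W) (K * ‖η‖)).exists_mapClusterPt
      (le_principal_iff.2 (mem_map.2 hmem))
    exact ⟨d, (isCompact_closedBall _ _).tendsto_nhds_of_unique_mapClusterPt hmem
      fun d' _ hd' => huniq η d' d hd' hd⟩
  choose D hD using hlim
  have hDlip : ∀ η η', ‖D η' - D η‖ ≤ K * ‖η' - η‖ := fun η η' =>
    le_of_tendsto ((hD η').sub (hD η)).norm (hlip2 η η')
  have hadd : ∀ η₁ η₂, D (η₁ + η₂) = D η₁ + D η₂ := fun η₁ η₂ => by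
    have hshift : Tendsto (fun z : V × ℝ => (z.1 + z.2 • η₁, z.2)) l l :=
      (tendsto_add_smul_of_prod tendsto_id (tendsto_const_nhds (x := η₁))).prodMk tendsto_snd
    refine tendsto_nhds_unique (hD _) (((hD η₁).add ((hD η₂).comp hshift)).congr fun z => ?_)
    simp only [diffQuot, Function.comp, ← smul_add, add_assoc]
    congr 1
    abel
  have hcont : Continuous D :=
    (LipschitzWith.of_dist_le_mul (K := K) fun a b => by
      simpa [dist_eq_norm] using hDlip b a).continuous
  let L : V →L[ℝ] W := (AddMonoidHom.mk' D hadd).toRealLinearMap hcont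
  have hL : ∀ η, L η = D η := fun η => rfl
  refine ⟨L, .of_isLittleO (Asymptotics.isLittleO_iff.2 fun ε hε => ?_)⟩
  have hloc : ∀ η ∈ sphere (0 : V) 1, ∀ᶠ w in l ×ˢ 𝓝 η, ‖diffQuot p w.2 w.1 - D w.2‖ < ε := by
    intro η _
    have h1 : ∀ᶠ w in l ×ˢ 𝓝 η, ‖diffQuot p η w.1 - D η‖ < ε / 2 := by
      have := ((hD η).sub_const (D η)).norm.comp (tendsto_fst (f := l) (g := 𝓝 η))
      exact this.eventually_lt_const (by simpa using half_pos hε)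
    have h2 : ∀ᶠ w in l ×ˢ 𝓝 η, 2 * (K * ‖w.2 - η‖) < ε / 2 := by
      have h : Tendsto (fun e : V => 2 * (K * ‖e - η‖)) (𝓝 η) (𝓝 0) :=
        Continuous.tendsto' (by fun_prop) _ _ (by simp)
      exact (h.comp (tendsto_snd (f := l) (g := 𝓝 η))).eventually_lt_const (half_pos hε)
    filter_upwards [h1, h2, eventually_norm_diffQuot_sub_le hs hp tendsto_fst tendsto_snd
      (tendsto_const_nhds (x := η))] with w h1 h2 h3
    have h4 := hDlip w.2 η
    rw [norm_sub_rev η] at h4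
    calc ‖diffQuot p w.2 w.1 - D w.2‖
        = ‖(diffQuot p w.2 w.1 - diffQuot p η w.1) + (diffQuot p η w.1 - D η)
            + (D η - D w.2)‖ := by congr 1; abel
      _ ≤ _ := norm_add₃_le
      _ < ε := by linarith
  have hunif : ∀ᶠ z in l, ∀ η ∈ sphere (0 : V) 1, ‖diffQuot p η z - D η‖ < ε := by
    have h := (isCompact_sphere (0 : V) 1).mem_prod_nhdsSet_of_forall hloc
    exact (Filter.Eventually.curry h).mono fun _ h => h.self_of_nhdsSet
  rw [hl, ← nhdsWithin_univ x₀, ← nhdsWithin_prod_eq, eventually_nhdsWithin_iff] at hunif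
  have hmap : Tendsto (fun q : V × V => (q.2, ‖q.1 - q.2‖)) (𝓝 (x₀, x₀)) (𝓝 (x₀, 0)) :=
    Continuous.tendsto' (by fun_prop) _ _ (by simp)
  filter_upwards [hmap.eventually hunif] with q hq
  rcases eq_or_ne q.1 q.2 with heq | hne
  · simp [heq]
  have ht : 0 < ‖q.1 - q.2‖ := norm_pos_iff.2 (sub_ne_zero.2 hne)
  have h := hq ⟨mem_univ _, ht⟩ (‖q.1 - q.2‖⁻¹ • (q.1 - q.2))
    (by simp [norm_smul, ht.ne'])
  rw [diffQuot, smul_inv_smul₀ ht.ne', add_sub_cancel, ← hL, map_smul, ← smul_sub, norm_smul,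
    norm_inv, norm_norm, inv_mul_lt_iff₀ ht] at h
  rw [mul_comm]
  exact h.le

end StrictDifferentiability

/-- Near `yb` the generalized proximal mapping is a single-valued Lipschitz map `p`, and the
prox-regularity inequality holds uniformly along its graph. -/
theorem exists_lipschitz_proxSet [ProperSpace E] {X : Set E} {Y : Set F} {Φ : E → F → ℝ}
    {g : E → EReal} {xb vb : E} {yb : F} {r ρ : ℝ} (hXcl : IsClosed X) (hYop : IsOpen Y)
    (hΦc : ContinuousOn (fun p : E × F => Φ p.1 p.2) (X ×ˢ Y))
    (hΦd2 : ContDiffOn ℝ 2 (fun p : E × F => Φ p.1 p.2) (interior X ×ˢ Y))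
    (hG : AssumptionG X Y Φ g) (hxb : xb ∈ interior X) (hpr : ProxRegularAt g xb vb r)
    (hyb : yb ∈ Y) (hprox : proxSet X Φ g yb = {xb}) (hvb : vb = gradx Φ xb yb)
    {D : E × F →L[ℝ] E}
    (hD : HasStrictFDerivAt (fun q : E × F => gradx Φ q.1 q.2) D (xb, yb)) (hρ : r < ρ)
    (hcoer : ∀ u, ρ * ‖u‖ ^ 2 ≤ -⟪D (u, 0), u⟫) :
    ∃ (p : F → E) (V : Set F) (K : ℝ≥0) (δ : ℝ), 0 < δ ∧ V ∈ 𝓝 yb ∧ V ⊆ Y ∧ p yb = xb ∧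
      LipschitzOnWith K p V ∧ Tendsto (fun y => g (p y)) (𝓝 yb) (𝓝 (g xb)) ∧
      ∀ y ∈ V, proxSet X Φ g y = {p y} ∧ g (p y) ≠ ⊤ ∧ ‖p y - xb‖ ≤ δ ∧
        IsLSubgrad g (p y) (gradx Φ (p y) y) ∧ ProxIneq g xb r δ (p y) (gradx Φ (p y) y) := by
  obtain ⟨htop, hbot, -, -, ε, hε, hreg⟩ := hpr
  obtain ⟨gb, hgb⟩ : ∃ gb : ℝ, g xb = gb := ⟨_, (EReal.coe_toReal htop hbot).symm⟩
  have hc : 0 < (ρ - r) / 2 := by linarith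
  have hlo := hD.isLittleO.def hc
  rw [nhds_prod_eq] at hlo
  obtain ⟨W, hW, hlo⟩ := eventually_prod_self_iff'.1 hlo
  have hP : ∀ᶠ q in 𝓝 xb ×ˢ 𝓝 yb, q ∈ W ∧ ‖gradx Φ q.1 q.2 - vb‖ ≤ ε ∧ ‖q.1 - xb‖ ≤ ε ∧
      q ∈ interior X ×ˢ Y := by
    rw [← nhds_prod_eq]
    have h1 : ContinuousAt (fun q : E × F => ‖gradx Φ q.1 q.2 - vb‖) (xb, yb) :=
      (hD.continuousAt.sub continuousAt_const).norm
    have h2 : ContinuousAt (fun q : E × F => ‖q.1 - xb‖) (xb, yb) := by fun_prop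
    filter_upwards [hW, h1.eventually_le_const (by simpa [hvb] using hε),
      h2.eventually_le_const (by simpa using hε),
      (isOpen_interior.prod hYop).mem_nhds (mk_mem_prod hxb hyb)] with q h1 h2 h3 h4
    exact ⟨h1, h2, h3, h4⟩
  obtain ⟨U, hU, V₀, hV₀, hUV⟩ := eventually_prod_iff.1 hP
  have hgood : ∀ᶠ y in 𝓝 yb, (proxSet X Φ g y).Nonempty ∧ ∀ x ∈ proxSet X Φ g y,
      ((x, y) ∈ W ∧ ‖gradx Φ x y - vb‖ ≤ ε ∧ ‖x - xb‖ ≤ ε ∧ (x, y) ∈ interior X ×ˢ Y) ∧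
      g x ≤ ((gb + ε : ℝ) : EReal) := by
    filter_upwards [eventually_proxSet_nonempty hXcl hYop hΦc hG (interior_subset hxb) hyb hgb,
      eventually_proxSet_subset hXcl hYop hΦc hG hyb hgb hprox hU, hV₀,
      eventually_value_mem_Icc hXcl hYop hΦc hG hxb hyb hgb hprox hε] with y h1 h2 h3 h4
    exact ⟨h1, fun x hx => ⟨hUV (h2 hx) h3, (h4 x hx).2⟩⟩
  set V := {y | (proxSet X Φ g y).Nonempty ∧ ∀ x ∈ proxSet X Φ g y,
      ((x, y) ∈ W ∧ ‖gradx Φ x y - vb‖ ≤ ε ∧ ‖x - xb‖ ≤ ε ∧ (x, y) ∈ interior X ×ˢ Y) ∧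
      g x ≤ ((gb + ε : ℝ) : EReal)} with hV
  have hsub : ∀ y ∈ V, ∀ x ∈ proxSet X Φ g y, g x ≠ ⊤ ∧ IsLSubgrad g x (gradx Φ x y) ∧
      ProxIneq g xb r ε x (gradx Φ x y) := by
    rintro y ⟨-, hy⟩ x hx
    obtain ⟨⟨-, h2, h3, h4⟩, h5⟩ := hy x hx
    have htopx : g x ≠ ⊤ := (h5.trans_lt (EReal.coe_lt_top _)).ne
    have hl : IsLSubgrad g x (gradx Φ x y) := isLSubgrad_gradx_of_mem_proxSet hx h4.1
      ((hΦd2.contDiffAt ((isOpen_interior.prod hYop).mem_nhds h4)).differentiableAt two_ne_zero)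
      htopx (hG.ne_bot x)
    exact ⟨htopx, hl, fun x' hx' => hreg x x' _ hx' h3 (by rwa [hgb, ← EReal.coe_add]) hl h2⟩
  have hlip : ∀ y₁ ∈ V, ∀ y₂ ∈ V, ∀ x₁ ∈ proxSet X Φ g y₁, ∀ x₂ ∈ proxSet X Φ g y₂,
      ‖x₁ - x₂‖ ≤ (‖D‖ + (ρ - r) / 2) / ((ρ - r) / 2) * ‖y₁ - y₂‖ := by
    intro y₁ hy₁ y₂ hy₂ x₁ hx₁ x₂ hx₂
    obtain ⟨ht₁, -, hp₁⟩ := hsub y₁ hy₁ x₁ hx₁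
    obtain ⟨ht₂, -, hp₂⟩ := hsub y₂ hy₂ x₂ hx₂
    have h₁ := (hy₁.2 x₁ hx₁).1
    have h₂ := (hy₂.2 x₂ hx₂).1
    exact norm_le_of_coercive hρ hcoer (hlo _ h₁.1 _ h₂.1)
      (hp₁.inner_sub_ge hp₂ h₁.2.2.1 h₂.2.2.1 ht₁ (hG.ne_bot _) ht₂ (hG.ne_bot _))
  have hex : ∀ y, ∃ x, y ∈ V → x ∈ proxSet X Φ g y := fun y => by
    by_cases hy : y ∈ V
    · exact ⟨_, fun _ => hy.1.some_mem⟩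
    · exact ⟨xb, fun h => absurd h hy⟩
  choose p hp using hex
  have hVn : V ∈ 𝓝 yb := hgood
  have hpyb : p yb = xb := by simpa [hprox] using hp yb (mem_of_mem_nhds hVn)
  refine ⟨p, V, Real.toNNReal ((‖D‖ + (ρ - r) / 2) / ((ρ - r) / 2)), ε, hε, hVn,
    fun y hy => ((hy.2 _ (hp y hy)).1.2.2.2).2, hpyb,
    LipschitzOnWith.of_dist_le_mul fun y₁ h₁ y₂ h₂ => ?_, ?_, fun y hy => ⟨?_, ?_⟩⟩
  · rw [dist_eq_norm, dist_eq_norm, Real.coe_toNNReal _ (by positivity)]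
    exact hlip _ h₁ _ h₂ _ (hp _ h₁) _ (hp _ h₂)
  · rw [hgb]
    refine tendsto_order.2 ⟨fun a ha => ?_, fun a ha => ?_⟩
    · obtain ⟨b, hab, hb⟩ := EReal.lt_iff_exists_real_btwn.1 ha
      rw [EReal.coe_lt_coe_iff] at hb
      filter_upwards [hVn, eventually_value_mem_Icc hXcl hYop hΦc hG hxb hyb hgb hprox
        (sub_pos.2 hb)] with y hy h
      have h := (h _ (hp y hy)).1
      rw [sub_sub_cancel] at h
      exact hab.trans_le h
    · obtain ⟨b, hb, hba⟩ := EReal.lt_iff_exists_real_btwn.1 ha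
      rw [EReal.coe_lt_coe_iff] at hb
      filter_upwards [hVn, eventually_value_mem_Icc hXcl hYop hΦc hG hxb hyb hgb hprox
        (sub_pos.2 hb)] with y hy h
      have h := (h _ (hp y hy)).2
      rw [add_sub_cancel] at h
      exact h.trans_lt hba
  · refine (subset_singleton_iff.2 fun x hx => ?_).antisymm (singleton_subset_iff.2 (hp y hy))
    simpa [sub_eq_zero] using hlip y hy y hy x hx _ (hp y hy)
  · obtain ⟨h1, h2, h3⟩ := hsub y hy _ (hp y hy)
    exact ⟨h1, (hy.2 _ (hp y hy)).1.2.2.1, h2, h3⟩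

section EpiLimit

/-- The second-order difference quotient of `g` at `x` for `v` with step `t`. -/
def secondDiffQuot (g : E → EReal) (x v : E) (t : ℝ) (w : E) : EReal :=
  ((2 / t ^ 2 : ℝ) : EReal) * (g (x + t • w) - g x - ((t * ⟪v, w⟫ : ℝ) : EReal))

variable {g : E → EReal} {xb : E} {r δ : ℝ}

theorem secondDiffQuot_zero {x v : E} {t : ℝ} (htop : g x ≠ ⊤) (hbot : g x ≠ ⊥) :
    secondDiffQuot g x v t 0 = 0 := by
  simp [secondDiffQuot, EReal.sub_self htop hbot]

theorem secondDiffQuot_add_le {x v v' e w : E} {t : ℝ} (ht : 0 < t)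
    (htop : g x ≠ ⊤) (hbot : g x ≠ ⊥) (htop' : g (x + t • e) ≠ ⊤) (hbot' : g (x + t • e) ≠ ⊥)
    (hp : ProxIneq g xb r δ (x + t • e) v') (hw : ‖x + t • w - xb‖ ≤ δ) :
    secondDiffQuot g x v t e +
        ((2 * ⟪t⁻¹ • (v' - v), w - e⟫ - r * ‖w - e‖ ^ 2 : ℝ) : EReal) ≤
      secondDiffQuot g x v t w := by
  have h := hp _ hw
  rw [secondDiffQuot, secondDiffQuot]
  rw [add_sub_add_left_eq_sub, ← smul_sub, norm_smul, Real.norm_of_nonneg ht.le,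
    real_inner_smul_right] at h
  have ht2 : 0 < 2 / t ^ 2 := by positivity
  lift g x to ℝ using ⟨htop, hbot⟩ with a
  lift g (x + t • e) to ℝ using ⟨htop', hbot'⟩ with a'
  induction hb : g (x + t • w) with
  | bot => rw [hb, ← EReal.coe_add, le_bot_iff] at h; exact absurd h (EReal.coe_ne_bot _)
  | top => rw [EReal.top_sub_coe, EReal.top_sub_coe, EReal.coe_mul_top_of_pos ht2]; exact le_top
  | coe b =>
    rw [hb, ← EReal.coe_add, EReal.coe_le_coe_iff] at h
    simp only [← EReal.coe_sub, ← EReal.coe_mul, ← EReal.coe_add, EReal.coe_le_coe_iff]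
    rw [real_inner_smul_left, inner_sub_left, inner_sub_right v]
    have h1 := mul_le_mul_of_nonneg_left h ht2.le
    have h2 : t ≠ 0 := ht.ne'
    have h3 : 2 / t ^ 2 * (a' - a - t * ⟪v, e⟫) + (2 * (t⁻¹ * (⟪v', w - e⟫ - (⟪v, w⟫ - ⟪v, e⟫))) -
        r * ‖w - e‖ ^ 2) = 2 / t ^ 2 * (a' + (t * ⟪v', w - e⟫ - r / 2 * (t * ‖w - e‖) ^ 2)) -
        2 / t ^ 2 * a - 2 / t ^ 2 * (t * ⟪v, w⟫) := by
      field_simp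
      ring
    linarith

variable {ts : ℕ → ℝ} {xs vs : ℕ → E} {h : E → EReal}

theorem liminf_secondDiffQuot_add_le (hδ : 0 < δ) (hts : ∀ ν, 0 < ts ν)
    (hts0 : Tendsto ts atTop (𝓝 0)) (hxs : Tendsto xs atTop (𝓝 xb))
    (hfin : ∀ ν, g (xs ν) ≠ ⊤ ∧ g (xs ν) ≠ ⊥)
    (hepi : EpiConvergesSeq (fun ν => secondDiffQuot g (xs ν) (vs ν) (ts ν)) h)
    {es vs' : ℕ → E} {e u : E} (he : Tendsto es atTop (𝓝 e))
    (hu : Tendsto (fun ν => (ts ν)⁻¹ • (vs' ν - vs ν)) atTop (𝓝 u))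
    (hfin' : ∀ ν, g (xs ν + ts ν • es ν) ≠ ⊤ ∧ g (xs ν + ts ν • es ν) ≠ ⊥)
    (hp : ∀ ν, ProxIneq g xb r δ (xs ν + ts ν • es ν) (vs' ν)) (w : E) :
    liminf (fun ν => secondDiffQuot g (xs ν) (vs ν) (ts ν) (es ν)) atTop +
      ((2 * ⟪u, w - e⟫ - r * ‖w - e‖ ^ 2 : ℝ) : EReal) ≤ h w := by
  obtain ⟨ws, hws, hlim⟩ := (hepi w).2
  have hc : Tendsto (fun ν => ((2 * ⟪(ts ν)⁻¹ • (vs' ν - vs ν), ws ν - es ν⟫ -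
      r * ‖ws ν - es ν‖ ^ 2 : ℝ) : EReal)) atTop
      (𝓝 ((2 * ⟪u, w - e⟫ - r * ‖w - e‖ ^ 2 : ℝ) : EReal)) :=
    (continuous_coe_real_ereal.tendsto _).comp
      (((hu.inner (hws.sub he)).const_mul 2).sub (((hws.sub he).norm.pow 2).const_mul r))
  have hnear : ∀ᶠ ν in atTop, ‖xs ν + ts ν • ws ν - xb‖ ≤ δ := by
    have h1 : Tendsto (fun ν => ‖xs ν + ts ν • ws ν - xb‖) atTop (𝓝 0) := by
      simpa using ((hxs.add (hts0.smul hws)).sub_const xb).norm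
    exact h1.eventually_le_const hδ
  rw [← hc.liminf_eq]
  refine EReal.le_liminf_add.trans ?_
  refine (liminf_le_liminf ?_).trans ((liminf_le_limsup).trans hlim)
  filter_upwards [hnear] with ν hν
  exact secondDiffQuot_add_le (hts ν) (hfin ν).1 (hfin ν).2 (hfin' ν).1 (hfin' ν).2 (hp ν) hν

/-- The epi-limit of second-order difference quotients is finite at the limit `d` of difference
quotients of the base points and satisfies a prox-regularity inequality there. -/
theorem epiLimit_finite_and_add_le (hδ : 0 < δ) (hts : ∀ ν, 0 < ts ν)
    (hts0 : Tendsto ts atTop (𝓝 0)) (hxs : Tendsto xs atTop (𝓝 xb))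
    (hfin : ∀ ν, g (xs ν) ≠ ⊤ ∧ g (xs ν) ≠ ⊥)
    (hepi : EpiConvergesSeq (fun ν => secondDiffQuot g (xs ν) (vs ν) (ts ν)) h)
    {es vs' : ℕ → E} {d u : E} (he : Tendsto es atTop (𝓝 d))
    (hu : Tendsto (fun ν => (ts ν)⁻¹ • (vs' ν - vs ν)) atTop (𝓝 u))
    (hfin' : ∀ ν, g (xs ν + ts ν • es ν) ≠ ⊤ ∧ g (xs ν + ts ν • es ν) ≠ ⊥)
    (hp : ∀ ν, ProxIneq g xb r δ (xs ν) (vs ν))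
    (hp' : ∀ ν, ProxIneq g xb r δ (xs ν + ts ν • es ν) (vs' ν)) :
    h d ≠ ⊤ ∧ h d ≠ ⊥ ∧
      ∀ w, h d + ((2 * ⟪u, w - d⟫ - r * ‖w - d‖ ^ 2 : ℝ) : EReal) ≤ h w := by
  have hzero : ∀ ν, secondDiffQuot g (xs ν) (vs ν) (ts ν) 0 = 0 := fun ν =>
    secondDiffQuot_zero (hfin ν).1 (hfin ν).2
  have h0 : h 0 ≤ 0 := by
    have := (hepi 0).1 (fun _ => 0) tendsto_const_nhds
    simpa [hzero] using this
  have hle : ∀ w, h d + ((2 * ⟪u, w - d⟫ - r * ‖w - d‖ ^ 2 : ℝ) : EReal) ≤ h w := fun w =>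
    (add_le_add_left ((hepi d).1 es he) _).trans
      (liminf_secondDiffQuot_add_le hδ hts hts0 hxs hfin hepi he hu hfin' hp' w)
  have hbot := liminf_secondDiffQuot_add_le (r := r) hδ hts hts0 hxs hfin hepi (e := 0) (u := 0)
    (es := fun _ => 0) (vs' := vs) tendsto_const_nhds (by simp) (by simpa using hfin)
    (by simpa using hp) d
  simp only [hzero, liminf_const, zero_add] at hbot
  refine ⟨fun htop => ?_, fun hb => ?_, hle⟩
  · have h1 := (hle 0).trans h0
    rw [htop, EReal.top_add_coe, top_le_iff] at h1
    exact EReal.zero_ne_top h1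
  · rw [hb, le_bot_iff] at hbot
    exact EReal.coe_ne_bot _ hbot

end EpiLimit

section StrictDiffProx

variable {Φ : E → F → ℝ} {g : E → EReal} {xb : E} {yb : F} {r δ : ℝ} {p : F → E} {V : Set F}
  {D : E × F →L[ℝ] E}

theorem epiLimit_add_le_of_mapClusterPt {h : E → EReal} (hδ : 0 < δ)
    (hbot : ∀ x, g x ≠ ⊥) (hV : V ∈ 𝓝 yb) (hpb : p yb = xb) (hpc : ContinuousAt p yb)
    (hgp : Tendsto (fun y => g (p y)) (𝓝 yb) (𝓝 (g xb)))
    (hp : ∀ y ∈ V, g (p y) ≠ ⊤ ∧ IsLSubgrad g (p y) (gradx Φ (p y) y) ∧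
      ProxIneq g xb r δ (p y) (gradx Φ (p y) y))
    (hD : HasStrictFDerivAt (fun q : E × F => gradx Φ q.1 q.2) D (xb, yb))
    (hepi : ∀ (ts : ℕ → ℝ) (xs vs : ℕ → E), (∀ ν, 0 < ts ν) → Tendsto ts atTop (𝓝 0) →
      Tendsto xs atTop (𝓝 xb) → Tendsto vs atTop (𝓝 (gradx Φ xb yb)) →
      (∀ ν, IsLSubgrad g (xs ν) (vs ν)) → Tendsto (fun ν => g (xs ν)) atTop (𝓝 (g xb)) →
      EpiConvergesSeq (fun ν => secondDiffQuot g (xs ν) (vs ν) (ts ν)) h)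
    {η : F} {d : E} (hd : MapClusterPt d (𝓝 yb ×ˢ 𝓝[>] (0 : ℝ)) (diffQuot p η)) :
    h d ≠ ⊤ ∧ h d ≠ ⊥ ∧
      ∀ w, h d + ((2 * ⟪D (d, η), w - d⟫ - r * ‖w - d‖ ^ 2 : ℝ) : EReal) ≤ h w := by
  obtain ⟨ψ, hψd, hψ⟩ := hd.exists_seq_tendsto
  have hev : ∀ᶠ ν in atTop, (ψ ν).1 ∈ V ∧ (ψ ν).1 + (ψ ν).2 • η ∈ V ∧ 0 < (ψ ν).2 :=
    ((tendsto_fst.comp hψ).eventually hV).and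
      (((tendsto_add_smul_of_prod hψ tendsto_const_nhds).eventually hV).and
        ((tendsto_snd.comp hψ).eventually self_mem_nhdsWithin))
  obtain ⟨N, hN⟩ := eventually_atTop.1 hev
  obtain ⟨z, hψ, hψd, hN⟩ : ∃ z : ℕ → F × ℝ, Tendsto z atTop (𝓝 yb ×ˢ 𝓝[>] (0 : ℝ)) ∧
      Tendsto (fun ν => diffQuot p η (z ν)) atTop (𝓝 d) ∧
      ∀ ν, (z ν).1 ∈ V ∧ (z ν).1 + (z ν).2 • η ∈ V ∧ 0 < (z ν).2 :=
    ⟨fun ν => ψ (ν + N), hψ.comp (tendsto_add_atTop_nat N), hψd.comp (tendsto_add_atTop_nat N),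
      fun ν => hN (ν + N) (Nat.le_add_left _ _)⟩
  have hy : Tendsto (fun ν => (z ν).1) atTop (𝓝 yb) := tendsto_fst.comp hψ
  have hy' : Tendsto (fun ν => (z ν).1 + (z ν).2 • η) atTop (𝓝 yb) :=
    tendsto_add_smul_of_prod hψ tendsto_const_nhds
  have ht : Tendsto (fun ν => (z ν).2) atTop (𝓝 0) :=
    (tendsto_snd.comp hψ).mono_right nhdsWithin_le_nhds
  have hpos : ∀ ν, 0 < (z ν).2 := fun ν => (hN ν).2.2
  have hx : Tendsto (fun ν => p (z ν).1) atTop (𝓝 xb) := by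
    rw [← hpb]; exact hpc.tendsto.comp hy
  have hx' : Tendsto (fun ν => p ((z ν).1 + (z ν).2 • η)) atTop (𝓝 xb) := by
    rw [← hpb]; exact hpc.tendsto.comp hy'
  have hstep : ∀ ν, p (z ν).1 + (z ν).2 • diffQuot p η (z ν) = p ((z ν).1 + (z ν).2 • η) :=
    fun ν => by rw [diffQuot, smul_inv_smul₀ (hpos ν).ne', add_sub_cancel]
  have hq : Tendsto (fun ν => ((z ν).2)⁻¹ • ((p ((z ν).1 + (z ν).2 • η), (z ν).1 + (z ν).2 • η) -
      (p (z ν).1, (z ν).1))) atTop (𝓝 (d, η)) := by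
    have h1 : ∀ ν, ((z ν).2)⁻¹ • ((p ((z ν).1 + (z ν).2 • η), (z ν).1 + (z ν).2 • η) -
        (p (z ν).1, (z ν).1)) = (diffQuot p η (z ν), η) := fun ν => by
      rw [Prod.mk_sub_mk, add_sub_cancel_left, Prod.smul_mk, inv_smul_smul₀ (hpos ν).ne', diffQuot]
    simp_rw [h1]
    exact Tendsto.prodMk_nhds hψd tendsto_const_nhds
  have hu := hD.tendsto_smul_sub
    (a := fun ν => (p ((z ν).1 + (z ν).2 • η), (z ν).1 + (z ν).2 • η))
    (b := fun ν => (p (z ν).1, (z ν).1)) (hx'.prodMk_nhds hy') (hx.prodMk_nhds hy) hq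
  have hE := hepi (fun ν => (z ν).2) (fun ν => p (z ν).1) (fun ν => gradx Φ (p (z ν).1) (z ν).1)
    hpos ht hx (hD.continuousAt.tendsto.comp (hx.prodMk_nhds hy)) (fun ν => (hp _ (hN ν).1).2.1)
    (hgp.comp hy)
  have hfin' : ∀ ν, g (p (z ν).1 + (z ν).2 • diffQuot p η (z ν)) ≠ ⊤ ∧
      g (p (z ν).1 + (z ν).2 • diffQuot p η (z ν)) ≠ ⊥ := fun ν => by
    rw [hstep]
    exact ⟨(hp _ (hN ν).2.1).1, hbot _⟩
  have hp' : ∀ ν, ProxIneq g xb r δ (p (z ν).1 + (z ν).2 • diffQuot p η (z ν))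
      (gradx Φ (p ((z ν).1 + (z ν).2 • η)) ((z ν).1 + (z ν).2 • η)) := fun ν => by
    rw [hstep]
    exact (hp _ (hN ν).2.1).2.2
  exact epiLimit_finite_and_add_le hδ hpos ht hx (fun ν => ⟨(hp _ (hN ν).1).1, hbot _⟩) hE hψd hu
    hfin' (fun ν => (hp _ (hN ν).1).2.2) hp'

theorem exists_hasStrictFDerivAt_prox [ProperSpace E] [ProperSpace F] {ρ : ℝ} {K : ℝ≥0}
    (hδ : 0 < δ) (hbot : ∀ x, g x ≠ ⊥) (hV : V ∈ 𝓝 yb) (hpb : p yb = xb)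
    (hlip : LipschitzOnWith K p V)
    (hgp : Tendsto (fun y => g (p y)) (𝓝 yb) (𝓝 (g xb)))
    (hp : ∀ y ∈ V, g (p y) ≠ ⊤ ∧ IsLSubgrad g (p y) (gradx Φ (p y) y) ∧
      ProxIneq g xb r δ (p y) (gradx Φ (p y) y))
    (hD : HasStrictFDerivAt (fun q : E × F => gradx Φ q.1 q.2) D (xb, yb))
    (hρ : r < ρ) (hcoer : ∀ u, ρ * ‖u‖ ^ 2 ≤ -⟪D (u, 0), u⟫)
    (hepi : StrictTwiceEpiDiff g xb (gradx Φ xb yb)) :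
    ∃ Dp : F →L[ℝ] E, HasStrictFDerivAt p Dp yb := by
  obtain ⟨h, hh⟩ := hepi
  refine exists_hasStrictFDerivAt_of_unique_mapClusterPt hV hlip fun η d d' hd hd' => ?_
  have hpc := hlip.continuousOn.continuousAt hV
  obtain ⟨ht, hb, hle⟩ := epiLimit_add_le_of_mapClusterPt hδ hbot hV hpb hpc hgp hp hD hh hd
  obtain ⟨ht', hb', hle'⟩ := epiLimit_add_le_of_mapClusterPt hδ hbot hV hpb hpc hgp hp hD hh hd'
  have h1 := hle d'
  have h2 := hle' d
  lift h d to ℝ using ⟨ht, hb⟩ with a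
  lift h d' to ℝ using ⟨ht', hb'⟩ with a'
  rw [← EReal.coe_add, EReal.coe_le_coe_iff] at h1 h2
  have h3 := hcoer (d - d')
  have h4 : D (d - d', 0) = D (d, η) - D (d', η) := by rw [← map_sub]; simp
  rw [h4, inner_sub_left] at h3
  rw [← neg_sub d d', inner_neg_right, norm_neg] at h1
  have h5 : (ρ - r) * ‖d - d'‖ ^ 2 ≤ 0 := by linarith
  have h6 : ‖d - d'‖ ^ 2 ≤ 0 := by
    by_contra! h
    exact absurd h5 (not_le.2 (mul_pos (sub_pos.2 hρ) h))
  exact sub_eq_zero.1 (norm_eq_zero.1 (pow_eq_zero_iff two_ne_zero |>.1 (h6.antisymm (sq_nonneg _))))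

end StrictDiffProx
theorem phi_conjugate_lipschitz_and_strict_twice_differentiable {n m : ℕ}
    (X : Set (EuclideanSpace ℝ (Fin n))) (Y : Set (EuclideanSpace ℝ (Fin m)))
    (Φ : EuclideanSpace ℝ (Fin n) → EuclideanSpace ℝ (Fin m) → ℝ)
    (hXcl : IsClosed X) (hXint : (interior X).Nonempty)
    (hYne : Y.Nonempty) (hYop : IsOpen Y)
    (hΦc : ContinuousOn (fun p : (EuclideanSpace ℝ (Fin n)) × (EuclideanSpace ℝ (Fin m)) => Φ p.1 p.2) (X ×ˢ Y))
    (hΦd2 : ContDiffOn ℝ 2 (fun p : (EuclideanSpace ℝ (Fin n)) × (EuclideanSpace ℝ (Fin m)) => Φ p.1 p.2) ((interior X) ×ˢ Y))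
    (g : EuclideanSpace ℝ (Fin n) → EReal) (hG : AssumptionG X Y Φ g)
    (xb vb : EuclideanSpace ℝ (Fin n)) (hxb : xb ∈ interior X)
    (r : ℝ) (hr : 0 < r) (hpr : ProxRegularAt g xb vb r)
    (yb : EuclideanSpace ℝ (Fin m)) (hyb : yb ∈ Y) (hprox : proxSet X Φ g yb = {xb})
    (hvb : vb = gradx Φ xb yb)
    (A : (EuclideanSpace ℝ (Fin n)) →L[ℝ] (EuclideanSpace ℝ (Fin n))) (hA : A = fderiv ℝ (fun x => gradx Φ x yb) xb)
    (hneg : ∀ u : EuclideanSpace ℝ (Fin n), u ≠ 0 → ⟪A u, u⟫ < 0)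
    (M : (EuclideanSpace ℝ (Fin n)) →L[ℝ] (EuclideanSpace ℝ (Fin n)))
    (hMA : M.comp A = -ContinuousLinearMap.id ℝ (EuclideanSpace ℝ (Fin n)))
    (hAM : A.comp M = -ContinuousLinearMap.id ℝ (EuclideanSpace ℝ (Fin n)))
    (lmax : ℝ) (hlmax : ∀ u : EuclideanSpace ℝ (Fin n), ⟪M u, u⟫ ≤ lmax * ‖u‖ ^ 2) (hlr : lmax < r⁻¹)
    (Byx : (EuclideanSpace ℝ (Fin n)) →L[ℝ] (EuclideanSpace ℝ (Fin m))) (hByx : Byx = fderiv ℝ (fun x => grady Φ x yb) xb)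
    (Byy : (EuclideanSpace ℝ (Fin m)) →L[ℝ] (EuclideanSpace ℝ (Fin m))) (hByy : Byy = fderiv ℝ (fun y => grady Φ xb y) yb) :
    (∃ U ∈ 𝓝 yb, ∃ (Gr : EuclideanSpace ℝ (Fin m) → EuclideanSpace ℝ (Fin m)) (K : ℝ≥0),
      (∀ y ∈ U, HasGradientAt (fun y' => (phiConj X Φ g y').toReal) (Gr y) y) ∧
      LipschitzOnWith K Gr U) ∧
    (∀ lamg : ℝ, StrictTwiceEpiDiff g xb vb → ProxBoundedWith g lamg → lmax < lamg →
      ∃ U ∈ 𝓝 yb, ∃ (Gr : EuclideanSpace ℝ (Fin m) → EuclideanSpace ℝ (Fin m)) (p : EuclideanSpace ℝ (Fin m) → EuclideanSpace ℝ (Fin n)) (Dp : (EuclideanSpace ℝ (Fin m)) →L[ℝ] (EuclideanSpace ℝ (Fin n))),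
        (∀ y ∈ U, HasGradientAt (fun y' => (phiConj X Φ g y').toReal) (Gr y) y) ∧
        (∀ y ∈ U, proxSet X Φ g y = {p y}) ∧ p yb = xb ∧
        HasStrictFDerivAt p Dp yb ∧
        HasStrictFDerivAt Gr (Byx.comp Dp + Byy) yb) := by
  have hnhds : interior X ×ˢ Y ∈ 𝓝 (xb, yb) :=
    (isOpen_interior.prod hYop).mem_nhds (mk_mem_prod hxb hyb)
  have h2 : ∀ q ∈ interior X ×ˢ Y, ContDiffAt ℝ 2 (fun p : _ × _ => Φ p.1 p.2) q := fun q hq =>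
    hΦd2.contDiffAt ((isOpen_interior.prod hYop).mem_nhds hq)
  have hb := h2 _ (mem_of_mem_nhds hnhds)
  obtain ⟨D, hD⟩ : ∃ D,
      HasStrictFDerivAt (fun q : _ × _ => gradx Φ q.1 q.2) D (xb, yb) :=
    ⟨_, (contDiffAt_gradx hb).hasStrictFDerivAt one_ne_zero⟩
  obtain ⟨D₂, hD₂⟩ : ∃ D₂,
      HasStrictFDerivAt (fun q : _ × _ => grady Φ q.1 q.2) D₂ (xb, yb) :=
    ⟨_, (contDiffAt_grady hb).hasStrictFDerivAt one_ne_zero⟩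
  have hAD : A = D.comp (.inl ℝ _ _) :=
    hA.trans (hasFDerivAt_partial_left (f := fun q : _ × _ => gradx Φ q.1 q.2) hD.hasFDerivAt).fderiv
  have hsymm : ∀ u w, ⟪A u, w⟫ = ⟪u, A w⟫ := by
    have h : ContDiffAt ℝ 2 (fun x => Φ x yb) xb :=
      hb.comp (f := fun x => (x, yb)) xb (contDiff_prodMk_left yb).contDiffAt
    rw [hA]
    exact isSymmetric_fderiv_gradient h
  obtain ⟨ρ, hρ, hcoer⟩ := exists_coercive_of_inverse_le hsymm hneg hAM hlmax hr hlr
  rw [hAD] at hcoer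
  replace hcoer : ∀ u, ρ * ‖u‖ ^ 2 ≤ -⟪D (u, 0), u⟫ := hcoer
  obtain ⟨p, V, K, δ, hδ, hV, hVY, hpb, hlip, hgp, hp⟩ := exists_lipschitz_proxSet hXcl hYop hΦc
    hΦd2 hG hxb hpr hyb hprox hvb hD hρ hcoer
  have hgrad : ∀ y ∈ interior V,
      HasGradientAt (fun y' => (phiConj X Φ g y').toReal) (grady Φ (p y) y) y := fun y hy => by
    have hVy : V ∈ 𝓝 y := mem_interior_iff_mem_nhds.1 hy
    have hmem : ∀ y ∈ V, p y ∈ proxSet X Φ g y := fun y hy => by simp [(hp y hy).1]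
    refine hasGradientAt_toReal_phiConj ?_ (hlip.continuousOn.continuousAt hVy)
      ((h2 (p y, y) ⟨hG.ran_interior y (hVY (interior_subset hy)) (hmem y (interior_subset hy)),
        hVY (interior_subset hy)⟩).hasStrictFDerivAt two_ne_zero)
    filter_upwards [hVy] with z hz
    exact ⟨hmem z hz, (hp z hz).2.1, hG.ne_bot _⟩
  have hiV : interior V ∈ 𝓝 yb := interior_mem_nhds.2 hV
  have hpc : ContinuousAt p yb := hlip.continuousOn.continuousAt hV
  constructor
  · obtain ⟨K₂, W, hW, hlip₂⟩ := ((contDiffAt_grady hb).exists_lipschitzOnWith)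
    have hpW : ∀ᶠ y in 𝓝 yb, (p y, y) ∈ W :=
      (hpc.prodMk continuousAt_id).eventually (by simpa [hpb] using hW)
    refine ⟨interior V ∩ {y | (p y, y) ∈ W}, inter_mem hiV hpW, fun y => grady Φ (p y) y,
      K₂ * max K 1,
      fun y hy => hgrad y hy.1, ?_⟩
    exact hlip₂.comp (f := fun y => (p y, y))
      ((hlip.mono (inter_subset_left.trans interior_subset)).prodMk
        LipschitzWith.id.lipschitzOnWith) fun y hy => hy.2
  · intro _ hepi _ _
    obtain ⟨Dp, hDp⟩ := exists_hasStrictFDerivAt_prox hδ hG.ne_bot hV hpb hlip hgp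
      (fun y hy => ⟨(hp y hy).2.1, (hp y hy).2.2.2⟩) hD hρ hcoer (hvb ▸ hepi)
    refine ⟨interior V, hiV, fun y => grady Φ (p y) y, p, Dp, hgrad,
      fun y hy => (hp y (interior_subset hy)).1, hpb, hDp, ?_⟩
    have hBx : Byx = D₂.comp (.inl ℝ _ _) := hByx.trans
      (hasFDerivAt_partial_left (f := fun q : _ × _ => grady Φ q.1 q.2) hD₂.hasFDerivAt).fderiv
    have hBy : Byy = D₂.comp (.inr ℝ _ _) := hByy.trans
      (hasFDerivAt_partial_right (f := fun q : _ × _ => grady Φ q.1 q.2) hD₂.hasFDerivAt).fderiv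
    have hcomp : HasStrictFDerivAt (fun y => grady Φ (p y) y)
        (D₂.comp (Dp.prod (.id ℝ _))) yb :=
      HasStrictFDerivAt.comp (f := fun y => (p y, y)) yb (by rwa [hpb])
        (hDp.prodMk (hasStrictFDerivAt_id yb))
    have hsum : Byx.comp Dp + Byy = D₂.comp (Dp.prod (.id ℝ _)) := by
      ext1 η
      rw [hBx, hBy]
      simp [← map_add]
    rwa [hsum]

end
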